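/- Under the setting of the per-step bound — E, W real inner product spaces; R : E → ℝ with L-Lipschitz gradient and ‖∇R‖ ≤ σ; 𝓛 : E × W → ℝ with ‖∇_θ𝓛‖ ≤ σ, mixed derivative bound σ′, and w ↦ R(F(θ, w)) having L-Lipschitz gradient for each θ; F(θ, w) = θ − μ·∇_θ𝓛(θ; w); updates θ_{t+1} = F(θ_t, w_{t+1}) and w_{t+1} = w_t − α·∇_w R(F(θ_t, w_t)) with μ, α ≥ 0 — the following telescoped bound holds for every T ≥ 1: ∑_{t=1}^{T} (α − (L·α²)/2)·‖∇_w R(F(θ_t, w_t))‖² ≤ R(θ₁) − R(θ_{T+1}) + T·(3·μ·σ² + (9/2)·L·μ²·σ² + 2·α·μ²·σ²·σ′²). -/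

import Mathlib

open RealInnerProductSpace

lemma descent_aux {W : Type*} [NormedAddCommGroup W] [InnerProductSpace ℝ W]
    (f : W → ℝ) (G : W → W) (L : ℝ)
    (hG : ∀ x, HasFDerivAt f (innerSL ℝ (G x)) x)
    (hl : ∀ x y, ‖G x - G y‖ ≤ L * ‖x - y‖) (x d : W) :
    f (x + d) ≤ f x + ⟪G x, d⟫ + L / 2 * ‖d‖ ^ 2 := by
  have hder : ∀ s : ℝ, HasDerivAt
      (fun s : ℝ => f (x + s • d) - s * ⟪G x, d⟫ - s ^ 2 * (L / 2 * ‖d‖ ^ 2))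
      (⟪G (x + s • d), d⟫ - ⟪G x, d⟫ - 2 * s * (L / 2 * ‖d‖ ^ 2)) s := by
    intro s
    have h1 : HasDerivAt (fun s : ℝ => x + s • d) d s := by
      simpa using ((hasDerivAt_id s).smul_const d).const_add x
    have h2 := (hG (x + s • d)).comp_hasDerivAt s h1
    have h3 := (hasDerivAt_id s).mul_const ⟪G x, d⟫
    have h4 := ((hasDerivAt_id s).pow 2).mul_const (L / 2 * ‖d‖ ^ 2)
    have h5 := (h2.sub h3).sub h4
    exact h5.congr_deriv (by simp)
  obtain ⟨c, hc, he⟩ := exists_hasDerivAt_eq_slope _ _ (zero_lt_one (α := ℝ))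
    (fun s _ => (hder s).continuousAt.continuousWithinAt) (fun s _ => hder s)
  have h6 : ⟪G (x + c • d) - G x, d⟫ ≤ c * L * ‖d‖ ^ 2 := by
    calc _ ≤ ‖G (x + c • d) - G x‖ * ‖d‖ := real_inner_le_norm _ _
      _ ≤ (L * ‖x + c • d - x‖) * ‖d‖ := by gcongr; exact hl _ _
      _ = _ := by
        rw [add_sub_cancel_left, norm_smul, Real.norm_of_nonneg hc.1.le]; ring
  rw [inner_sub_left] at h6
  simp at he
  linarith

/-- The telescoped bound (Eqn. 34) in the proof of Theorem 2:
`∑_{t=1}^{T} (α - L α² / 2) ‖∇_w R(F(θ_t, w_t))‖²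
  ≤ R θ₁ - R θ_{T+1} + T (3 μ σ² + (9/2) L μ² σ² + 2 α μ² σ² σ'²)`. -/
theorem telescoped_bound
    {E W : Type*} [NormedAddCommGroup E] [InnerProductSpace ℝ E]
    [NormedAddCommGroup W] [InnerProductSpace ℝ W]
    (R : E → ℝ) (R' : E → E) (L σ σ' : ℝ) (hL : 0 ≤ L)
    (hRdiff : ∀ x, HasFDerivAt R (innerSL ℝ (R' x)) x)
    (hRlip : ∀ x y, ‖R' x - R' y‖ ≤ L * ‖x - y‖)
    (hRbound : ∀ x, ‖R' x‖ ≤ σ)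
    (𝓛 : E → W → ℝ) (𝓛' : E → W → E)
    (h𝓛diff : ∀ θ₀ w₀, HasFDerivAt (fun θ => 𝓛 θ w₀) (innerSL ℝ (𝓛' θ₀ w₀)) θ₀)
    (h𝓛bound : ∀ θ₀ w₀, ‖𝓛' θ₀ w₀‖ ≤ σ)
    (D : E → W → (W →L[ℝ] E))
    (hD : ∀ θ₀ w₀, HasFDerivAt (fun w => 𝓛' θ₀ w) (D θ₀ w₀) w₀)
    (hDbound : ∀ θ₀ w₀, ‖D θ₀ w₀‖ ≤ σ')
    (μ : ℝ) (hμ : 0 ≤ μ)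
    (F : E → W → E) (hF : ∀ θ₀ w₀, F θ₀ w₀ = θ₀ - μ • 𝓛' θ₀ w₀)
    (G : E → W → W)
    (hG : ∀ θ₀ w₀, HasFDerivAt (fun w => R (F θ₀ w)) (innerSL ℝ (G θ₀ w₀)) w₀)
    (hGlip : ∀ θ₀ w₁ w₂, ‖G θ₀ w₁ - G θ₀ w₂‖ ≤ L * ‖w₁ - w₂‖)
    (θ : ℕ → E) (w : ℕ → W) (α : ℝ) (hα : 0 ≤ α)
    (hθupd : ∀ t, θ (t + 1) = F (θ t) (w (t + 1)))
    (hwupd : ∀ t, w (t + 1) = w t - α • G (θ t) (w t))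
    (T : ℕ) (hT : 1 ≤ T) :
    ∑ t ∈ Finset.Icc 1 T, (α - L * α ^ 2 / 2) * ‖G (θ t) (w t)‖ ^ 2 ≤
      R (θ 1) - R (θ (T + 1)) +
        (T : ℝ) * (3 * μ * σ ^ 2 + (9 / 2) * L * μ ^ 2 * σ ^ 2 +
          2 * α * μ ^ 2 * σ ^ 2 * σ' ^ 2) := by
  have hσ : 0 ≤ σ := (norm_nonneg _).trans (hRbound 0)
  have hstep : ∀ t, (α - L * α ^ 2 / 2) * ‖G (θ t) (w t)‖ ^ 2 ≤ R (θ t) - R (θ (t + 1)) +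
      (3 * μ * σ ^ 2 + (9 / 2) * L * μ ^ 2 * σ ^ 2 + 2 * α * μ ^ 2 * σ ^ 2 * σ' ^ 2) := by
    intro t
    have h1 := descent_aux (fun v => R (F (θ t) v)) (G (θ t)) L (hG (θ t)) (hGlip (θ t))
      (w t) (-(α • G (θ t) (w t)))
    simp only [← sub_eq_add_neg] at h1
    rw [← hwupd, ← hθupd, inner_neg_right, norm_neg, real_inner_smul_right,
      real_inner_self_eq_norm_sq, norm_smul, Real.norm_of_nonneg hα] at h1
    have h2 := convex_univ.norm_image_sub_le_of_norm_hasFDerivWithin_le (𝕜 := ℝ)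
      (fun x _ => (hRdiff x).hasFDerivWithinAt) (C := σ)
      (fun x _ => by rw [innerSL_apply_norm]; exact hRbound x)
      (Set.mem_univ (θ t)) (Set.mem_univ (F (θ t) (w t)))
    have h3 : ‖F (θ t) (w t) - θ t‖ ≤ μ * σ := by
      rw [hF, sub_sub_cancel_left, norm_neg, norm_smul, Real.norm_of_nonneg hμ]
      exact mul_le_mul_of_nonneg_left (h𝓛bound _ _) hμ
    have h4 := (le_abs_self _).trans (h2.trans (mul_le_mul_of_nonneg_left h3 hσ))
    have h5 : 0 ≤ 2 * μ * σ ^ 2 := by positivity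
    have h6 : 0 ≤ (9 / 2) * L * μ ^ 2 * σ ^ 2 := by positivity
    have h7 : 0 ≤ 2 * α * μ ^ 2 * σ ^ 2 * σ' ^ 2 := by positivity
    nlinarith
  clear hT
  induction T with
  | zero => simp
  | succ n ih =>
    rw [Finset.sum_Icc_succ_top (by omega)]
    have := hstep (n + 1)
    push_cast
    linarith
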